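/- Let μ ∈ ℝ^d, θ > 0, and 0 < r < s. Let X be an ℝ^d-valued random variable with distribution P = f·λ_d such that E|X|^{r+η} < ∞ for some η > 0, and assume (θ,μ) is P-admissible. Let (α_n)_{n≥1} be an L^r(P)-optimal sequence of n-quantizers and suppose that ψ_b^{s/(d+r)} ∈ L^1(P_{θ,μ}) for some b ∈ (0,1/2). Then (α_n^{θ,μ})_{n≥1} is L^s(P)-rate-optimal if and only if ∫_{ℝ^d} f_{θ,μ} · f^{−s/(d+r)} dλ_d < ∞. -/

import Mathlib

open MeasureTheory ENNReal Filter Set Metric Topology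
open scoped Classical

noncomputable section

/-- Distance from a point `x` to a finite codebook `α`. -/
def qdist {d : ℕ} (x : EuclideanSpace ℝ (Fin d)) (α : Finset (EuclideanSpace ℝ (Fin d))) : ℝ :=
  Metric.infDist x (α : Set (EuclideanSpace ℝ (Fin d)))

/-- The `r`-th power `L^r` quantization error `∫ d(x,α)^r dP` of a codebook `α`. -/
def qerr {d : ℕ} (P : Measure (EuclideanSpace ℝ (Fin d))) (r : ℝ)
    (α : Finset (EuclideanSpace ℝ (Fin d))) : ℝ≥0∞ :=
  ∫⁻ x, ENNReal.ofReal (qdist x α) ^ r ∂P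

/-- The optimal `n`-level `L^r` quantization error `e_{n,r}(P)`. -/
def enr {d : ℕ} (P : Measure (EuclideanSpace ℝ (Fin d))) (r : ℝ) (n : ℕ) : ℝ≥0∞ :=
  ⨅ (α : Finset (EuclideanSpace ℝ (Fin d))) (_ : α.Nonempty) (_ : α.card ≤ n),
    qerr P r α ^ (1 / r)

/-- The uniform distribution on the unit cube `[0,1]^d`. -/
def unifCube (d : ℕ) : Measure (EuclideanSpace ℝ (Fin d)) :=
  volume.restrict {x | ∀ i, x i ∈ Icc (0 : ℝ) 1}

/-- The constant `J_{r,d} = inf_{n ≥ 1} n^{r/d} e_{n,r}(U([0,1]^d))^r`. -/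
def Jrd (r : ℝ) (d : ℕ) : ℝ≥0∞ :=
  ⨅ (n : ℕ) (_ : 1 ≤ n), (n : ℝ≥0∞) ^ (r / (d : ℝ)) * enr (unifCube d) r n ^ r

/-- Zador's constant `Q_r(P)` for a measure whose a.c. part has density `f`. -/
def Qr {d : ℕ} (f : EuclideanSpace ℝ (Fin d) → ℝ) (r : ℝ) : ℝ≥0∞ :=
  Jrd r d * (∫⁻ x, ENNReal.ofReal (f x) ^ ((d : ℝ) / ((d : ℝ) + r))) ^ (((d : ℝ) + r) / (d : ℝ))

/-- The dilated/contracted codebook `α^{θ,μ} = μ + θ(α - μ)`. -/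
def dilate {d : ℕ} (α : Finset (EuclideanSpace ℝ (Fin d))) (θ : ℝ)
    (μ : EuclideanSpace ℝ (Fin d)) : Finset (EuclideanSpace ℝ (Fin d)) :=
  α.image fun a => μ + θ • (a - μ)

/-- `f_{θ,μ}(x) = f(μ + θ(x-μ))`. -/
def fdil {d : ℕ} (f : EuclideanSpace ℝ (Fin d) → ℝ) (θ : ℝ)
    (μ x : EuclideanSpace ℝ (Fin d)) : ℝ :=
  f (μ + θ • (x - μ))

/-- The image measure `P_{θ,μ}` of `P` under `x ↦ (x-μ)/θ + μ`. -/
def Pdil {d : ℕ} (P : Measure (EuclideanSpace ℝ (Fin d))) (θ : ℝ)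
    (μ : EuclideanSpace ℝ (Fin d)) : Measure (EuclideanSpace ℝ (Fin d)) :=
  Measure.map (fun x => μ + θ⁻¹ • (x - μ)) P

/-- `(θ,μ)` is `P`-admissible for `P = f·λ_d`:
`{f>0} ⊆ μ(1-θ) + θ{f>0}` up to a `λ_d`-null set.  (Note that
`x ∈ μ(1-θ) + θ{f>0}` iff `f((x-μ)/θ + μ) > 0`.) -/
def Admissible {d : ℕ} (f : EuclideanSpace ℝ (Fin d) → ℝ) (θ : ℝ)
    (μ : EuclideanSpace ℝ (Fin d)) : Prop :=
  ∀ᵐ x ∂(volume : Measure (EuclideanSpace ℝ (Fin d))),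
    0 < f x → 0 < f (μ + θ⁻¹ • (x - μ))

/-- The maximal function `ψ_b` attached to `P` and the sequence of codebooks `α`. -/
def maxFun {d : ℕ} (P : Measure (EuclideanSpace ℝ (Fin d)))
    (α : ℕ → Finset (EuclideanSpace ℝ (Fin d))) (b : ℝ)
    (x : EuclideanSpace ℝ (Fin d)) : ℝ≥0∞ :=
  ⨆ (n : ℕ) (_ : 1 ≤ n),
    volume (Metric.ball x (b * qdist x (α n))) / P (Metric.ball x (b * qdist x (α n)))

/-- An `L^r(P)`-optimal sequence of `n`-quantizers. -/
def OptimalSeq {d : ℕ} (P : Measure (EuclideanSpace ℝ (Fin d))) (r : ℝ)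
    (α : ℕ → Finset (EuclideanSpace ℝ (Fin d))) : Prop :=
  ∀ n, 1 ≤ n → (α n).Nonempty ∧ (α n).card ≤ n ∧ qerr P r (α n) = enr P r n ^ r

/-- An asymptotically `L^r(P)`-optimal sequence of quantizers,
for `P` whose a.c. part has density `f`. -/
def AsympOptimalSeq {d : ℕ} (P : Measure (EuclideanSpace ℝ (Fin d)))
    (f : EuclideanSpace ℝ (Fin d) → ℝ) (r : ℝ)
    (α : ℕ → Finset (EuclideanSpace ℝ (Fin d))) : Prop :=
  (∀ n, 1 ≤ n → (α n).Nonempty ∧ (α n).card ≤ n) ∧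
  Tendsto (fun n : ℕ => (n : ℝ≥0∞) ^ (r / (d : ℝ)) * qerr P r (α n)) atTop (𝓝 (Qr f r))

/-- `L^s(P)`-rate-optimality of a sequence of codebooks. -/
def RateOptimal {d : ℕ} (P : Measure (EuclideanSpace ℝ (Fin d))) (s : ℝ)
    (β : ℕ → Finset (EuclideanSpace ℝ (Fin d))) : Prop :=
  limsup (fun n : ℕ => (n : ℝ≥0∞) ^ (s / (d : ℝ)) * qerr P s (β n)) atTop < ⊤

/-- The support of a measure. -/
def msupp {d : ℕ} (P : Measure (EuclideanSpace ℝ (Fin d))) : Set (EuclideanSpace ℝ (Fin d)) :=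
  {x | ∀ ε > 0, 0 < P (Metric.ball x ε)}

/-- Hypothesis (H1): for every `M > 0`,
`sup { f(μ+θ(z-μ))/f(z) : z ∈ B(0,M), f(z) > 0 } < ∞`. -/
def H1 {d : ℕ} (f : EuclideanSpace ℝ (Fin d) → ℝ) (θ : ℝ)
    (μ : EuclideanSpace ℝ (Fin d)) : Prop :=
  ∀ M > (0 : ℝ), ∃ C : ℝ, ∀ z ∈ Metric.ball (0 : EuclideanSpace ℝ (Fin d)) M,
    0 < f z → f (μ + θ • (z - μ)) / f z ≤ C

/-- Hypothesis (H2). -/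
def H2 {d : ℕ} (P : Measure (EuclideanSpace ℝ (Fin d))) (θ : ℝ)
    (μ : EuclideanSpace ℝ (Fin d)) (s r : ℝ) : Prop :=
  ∃ b ∈ Ioo (0 : ℝ) (1 / 2), ∃ M > (0 : ℝ),
    (∫⁻ x in {x : EuclideanSpace ℝ (Fin d) | M < ‖x‖},
      (⨆ t ∈ Ioc (0 : ℝ) (2 * b * ‖x‖),
        volume (Metric.ball x t) / P (Metric.ball x t)) ^ (s / ((d : ℝ) + r))
      ∂(Pdil P θ μ)) < ⊤

/-- Hypothesis (H3): `λ_d(· ∩ supp P) ≪ P` and `supp P` is a finite union of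
closed convex sets. -/
def H3 {d : ℕ} (P : Measure (EuclideanSpace ℝ (Fin d))) : Prop :=
  volume.restrict (msupp P) ≪ P ∧
  ∃ (k : ℕ) (C : Fin k → Set (EuclideanSpace ℝ (Fin d))),
    (∀ i, IsClosed (C i) ∧ Convex ℝ (C i)) ∧ msupp P = ⋃ i, C i

/-- A `δ`-separated finite subset of a ball of radius `R` has at most `(1 + 2R/δ)^d` points. -/
lemma card_le_of_dist_ge {d : ℕ} {R δ : ℝ} (hR : 0 ≤ R) (hδ : 0 < δ)
    (A : Finset (EuclideanSpace ℝ (Fin d))) (hA : ∀ a ∈ A, ‖a‖ ≤ R)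
    (hsep : ∀ a ∈ A, ∀ c ∈ A, a ≠ c → δ ≤ dist a c) :
    (A.card : ℝ) ≤ (1 + 2 * R / δ) ^ d := by
  have D : Set.Pairwise (A : Set (EuclideanSpace ℝ (Fin d)))
      (Function.onFun Disjoint fun c => ball c (δ / 2)) := by
    intro a ha c hc hac
    exact ball_disjoint_ball (by linarith [hsep a ha c hc hac])
  have hsub : ⋃ c ∈ A, ball c (δ / 2) ⊆ ball (0 : EuclideanSpace ℝ (Fin d)) (R + δ / 2) := by
    refine iUnion₂_subset fun c hc => ball_subset_ball' ?_
    rw [dist_zero_right]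
    linarith [hA c hc]
  have hvol := measure_mono (μ := (volume : Measure (EuclideanSpace ℝ (Fin d)))) hsub
  rw [measure_biUnion_finset D fun c _ => measurableSet_ball,
    Measure.addHaar_ball_of_pos _ _ (by positivity : 0 < R + δ / 2)] at hvol
  simp only [Measure.addHaar_ball_of_pos _ _ (half_pos hδ), Finset.sum_const, nsmul_eq_mul,
    ← mul_assoc, finrank_euclideanSpace_fin] at hvol
  have hcard := ENNReal.toReal_le_of_le_ofReal (by positivity)
    ((ENNReal.mul_le_mul_iff_left (measure_ball_pos _ _ zero_lt_one).ne'
      measure_ball_lt_top.ne).1 hvol)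
  rw [ENNReal.toReal_mul, ENNReal.toReal_natCast, ENNReal.toReal_ofReal (by positivity),
    ← le_div_iff₀ (by positivity), ← div_pow] at hcard
  refine hcard.trans_eq (congrArg (· ^ d) ?_)
  field_simp
  ring

/-- A ball of radius `R` is covered by `N` balls of radius `3 R N^{-1/d}`. -/
lemma exists_finset_qdist_le {d : ℕ} (hd : 1 ≤ d) {R : ℝ} (hR : 0 < R) {N : ℕ} (hN : 1 ≤ N) :
    ∃ A : Finset (EuclideanSpace ℝ (Fin d)), A.card ≤ N ∧
      ∀ x, ‖x‖ ≤ R → ∃ a ∈ A, dist x a ≤ 3 * R * (N : ℝ) ^ (-(1 / d : ℝ)) := by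
  have hN0 : (0 : ℝ) < N := by exact_mod_cast hN
  have hd0 : (0 : ℝ) < d := by exact_mod_cast hd
  set y : ℝ := (N : ℝ) ^ (1 / d : ℝ) with hy
  have hy0 : 0 < y := by positivity
  have hyd : y ^ d = N := by
    rw [hy, ← Real.rpow_natCast, ← Real.rpow_mul hN0.le]
    field_simp
    simp
  rw [Real.rpow_neg hN0.le, ← hy]
  rcases lt_or_ge y 3 with h3 | h3
  · refine ⟨{0}, by simpa using hN, fun x hx => ⟨0, by simp, ?_⟩⟩
    rw [dist_zero_right, ← div_eq_mul_inv, le_div_iff₀ hy0]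
    nlinarith [norm_nonneg x]
  set δ : ℝ := 3 * R * y⁻¹ with hδ
  have hδ0 : 0 < δ := by positivity
  let S : Set ℕ := {m | ∃ A : Finset (EuclideanSpace ℝ (Fin d)), A.card = m ∧
    (∀ a ∈ A, ‖a‖ ≤ R) ∧ ∀ a ∈ A, ∀ c ∈ A, a ≠ c → δ ≤ dist a c}
  have hS : ∀ m ∈ S, m ≤ N := by
    rintro m ⟨A, rfl, hA, hsep⟩
    have h1 := card_le_of_dist_ge hR.le hδ0 A hA hsep
    have h2 : 1 + 2 * R / δ ≤ y := by
      rw [hδ]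
      field_simp
      linarith
    have h3 : (1 + 2 * R / δ) ^ d ≤ y ^ d := by gcongr
    rw [hyd] at h3
    exact_mod_cast h1.trans h3
  have hSne : S.Nonempty := ⟨0, ∅, by simp⟩
  have hSb : BddAbove S := ⟨N, hS⟩
  obtain ⟨A, hAc, hA, hsep⟩ := Nat.sSup_mem hSne hSb
  refine ⟨A, hAc ▸ hS _ (Nat.sSup_mem hSne hSb), fun x hx => ?_⟩
  by_contra! hfar
  have hxA : x ∉ A := fun h => by
    have := hfar x h
    rw [dist_self] at this
    linarith
  have hmem : (insert x A).card ∈ S := by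
    refine ⟨insert x A, rfl, ?_, ?_⟩
    · simpa [hx] using hA
    · intro a ha c hc hac
      rcases Finset.mem_insert.1 ha with rfl | ha' <;> rcases Finset.mem_insert.1 hc with rfl | hc'
      · exact absurd rfl hac
      · exact (hfar c hc').le
      · rw [dist_comm]
        exact (hfar a ha').le
      · exact hsep a ha' c hc' hac
  have := le_csSup hSb hmem
  rw [Finset.card_insert_of_notMem hxA] at this
  omega

/-- The distance to a codebook is bounded by the distance to any of its points. -/
lemma qdist_le_dist {d : ℕ} {x a : EuclideanSpace ℝ (Fin d)}
    {α : Finset (EuclideanSpace ℝ (Fin d))} (ha : a ∈ α) : qdist x α ≤ dist x a :=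
  infDist_le_dist_of_mem (Finset.mem_coe.2 ha)

lemma qdist_nonneg {d : ℕ} (x : EuclideanSpace ℝ (Fin d))
    (α : Finset (EuclideanSpace ℝ (Fin d))) : 0 ≤ qdist x α :=
  infDist_nonneg

lemma measurable_qdist {d : ℕ} (α : Finset (EuclideanSpace ℝ (Fin d))) :
    Measurable fun x => qdist x α :=
  (continuous_infDist_pt _).measurable

/-- A codebook of size `n` whose distance to `x` is `O(n^{-1/d} |x|^{1+κ})` at infinity: it is made
of nets of geometrically decreasing sizes in the balls of radius `2^k`. -/
lemma exists_codebook_qdist_le {d : ℕ} (hd : 1 ≤ d) {κ : ℝ} (hκ : 0 < κ) :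
    ∃ C > (0 : ℝ), ∀ n : ℕ, 1 ≤ n → ∃ β : Finset (EuclideanSpace ℝ (Fin d)),
      β.Nonempty ∧ β.card ≤ n ∧
        ∀ x, qdist x β ≤ C * (n : ℝ) ^ (-(1 / d : ℝ)) * max 1 ‖x‖ ^ (1 + κ) := by
  have hd0 : (0 : ℝ) < d := by exact_mod_cast hd
  set q : ℝ := 2 ^ (-(d * κ)) with hq
  have hq0 : 0 < q := by positivity
  have hq1 : q < 1 := Real.rpow_lt_one_of_one_lt_of_neg one_lt_two (by
    have : 0 < d * κ := by positivity
    linarith)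
  set c : ℝ := (1 - q) / 2 with hc
  have hc0 : 0 < c := by rw [hc]; linarith
  refine ⟨3 * (c / 2) ^ (-(1 / d : ℝ)) * 2 ^ (1 + κ), by positivity, fun n hn => ?_⟩
  have hn0 : (0 : ℝ) < n := by exact_mod_cast hn
  let u : ℕ → ℝ := fun k => n * c * q ^ k
  have hu0 : ∀ k, 0 < u k := fun k => by positivity
  let N : ℕ → ℕ := fun k => ⌊u k⌋₊
  have hA : ∀ k, ∃ A : Finset (EuclideanSpace ℝ (Fin d)), A.card ≤ N k ∧
      (1 ≤ N k → ∀ x, ‖x‖ ≤ (2 : ℝ) ^ k → ∃ a ∈ A,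
        dist x a ≤ 3 * (2 : ℝ) ^ k * (N k : ℝ) ^ (-(1 / d : ℝ))) := by
    intro k
    by_cases h : 1 ≤ N k
    · obtain ⟨A, h1, h2⟩ := exists_finset_qdist_le hd (by positivity : (0 : ℝ) < 2 ^ k) h
      exact ⟨A, h1, fun _ => h2⟩
    · exact ⟨∅, by simp, fun h' => absurd h' h⟩
  choose A hAc hA using hA
  obtain ⟨K, hK⟩ := exists_pow_lt_of_lt_one (by positivity : 0 < (n * c)⁻¹) hq1
  have huK : u K < 1 := by
    have := mul_lt_mul_of_pos_left hK (by positivity : 0 < n * c)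
    rwa [mul_inv_cancel₀ (by positivity)] at this
  refine ⟨insert 0 ((Finset.range K).biUnion A), Finset.insert_nonempty _ _, ?_, fun x => ?_⟩
  · have h1 : ((∑ k ∈ Finset.range K, N k : ℕ) : ℝ) ≤ n / 2 := by
      push_cast
      calc ∑ k ∈ Finset.range K, (N k : ℝ) ≤ ∑ k ∈ Finset.range K, n * c * q ^ k :=
            Finset.sum_le_sum fun k _ => Nat.floor_le (hu0 k).le
        _ = n / 2 * (1 - q ^ K) := by
            rw [← Finset.mul_sum, ← mul_neg_geom_sum q K, hc]
            ring
        _ ≤ n / 2 * 1 := by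
            gcongr
            linarith [pow_pos hq0 K]
        _ = n / 2 := mul_one _
    have h2 : 2 * ∑ k ∈ Finset.range K, N k ≤ n := by
      have : (2 : ℝ) * ((∑ k ∈ Finset.range K, N k : ℕ) : ℝ) ≤ n := by linarith
      exact_mod_cast this
    have h3 := Finset.card_insert_le (0 : EuclideanSpace ℝ (Fin d)) ((Finset.range K).biUnion A)
    have h4 : ((Finset.range K).biUnion A).card ≤ ∑ k ∈ Finset.range K, N k :=
      Finset.card_biUnion_le.trans (Finset.sum_le_sum fun k _ => hAc k)
    omega
  · have hex : ∃ k : ℕ, ‖x‖ ≤ (2 : ℝ) ^ k := (pow_unbounded_of_one_lt ‖x‖ one_lt_two).imp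
      fun k hk => hk.le
    obtain ⟨k, hk, hkm⟩ : ∃ k : ℕ, ‖x‖ ≤ (2 : ℝ) ^ k ∧ (2 : ℝ) ^ k ≤ 2 * max 1 ‖x‖ := by
      refine ⟨Nat.find hex, Nat.find_spec hex, ?_⟩
      rcases h : Nat.find hex with _ | k
      · have := le_max_left 1 ‖x‖
        rw [pow_zero]
        linarith
      · have h1 : (2 : ℝ) ^ k < ‖x‖ := not_le.1 (Nat.find_min hex (by omega))
        have := le_max_right 1 ‖x‖
        rw [pow_succ]
        linarith
    set t : ℝ := 2 ^ k with ht
    have ht0 : 0 < t := by positivity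
    have hexp : -(1 / d : ℝ) ≤ 0 := by
      rw [neg_nonpos]
      positivity
    have hmain : qdist x (insert 0 ((Finset.range K).biUnion A))
        ≤ 3 * t * (u k / 2) ^ (-(1 / d : ℝ)) := by
      by_cases hN : 1 ≤ N k
      · have hu1 : 1 ≤ u k := (Nat.one_le_floor_iff _).1 hN
        have hkK : k < K := by
          by_contra! h
          have : u k ≤ u K := by
            have := pow_le_pow_of_le_one hq0.le hq1.le h
            exact mul_le_mul_of_nonneg_left this (by positivity)
          linarith
        obtain ⟨a, ha, hxa⟩ := hA k hN x hk
        refine (qdist_le_dist (Finset.mem_insert_of_mem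
          (Finset.mem_biUnion.2 ⟨k, Finset.mem_range.2 hkK, ha⟩))).trans (hxa.trans ?_)
        refine mul_le_mul_of_nonneg_left ?_ (by positivity)
        refine Real.rpow_le_rpow_of_nonpos (by linarith) ?_ hexp
        have h1 := Nat.lt_floor_add_one (u k)
        have h2 : (1 : ℝ) ≤ N k := by exact_mod_cast hN
        change u k < N k + 1 at h1
        linarith
      · have hu1 : u k < 1 := by
          by_contra! h
          exact hN ((Nat.one_le_floor_iff _).2 h)
        refine (qdist_le_dist (Finset.mem_insert_self _ _)).trans ?_
        rw [dist_zero_right]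
        have h1 : 1 ≤ (u k / 2) ^ (-(1 / d : ℝ)) :=
          Real.one_le_rpow_of_pos_of_le_one_of_nonpos (by linarith [hu0 k]) (by linarith) hexp
        nlinarith
    refine hmain.trans ?_
    have hqk : (q ^ k) ^ (-(1 / d : ℝ)) = t ^ κ := by
      rw [hq, ht, ← Real.rpow_natCast, ← Real.rpow_mul zero_le_two, ← Real.rpow_mul zero_le_two,
        ← Real.rpow_natCast 2 k, ← Real.rpow_mul zero_le_two]
      congr 1
      field_simp
    have hsplit : (u k / 2) ^ (-(1 / d : ℝ))
        = (c / 2) ^ (-(1 / d : ℝ)) * (n : ℝ) ^ (-(1 / d : ℝ)) * t ^ κ := by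
      rw [← hqk, ← Real.mul_rpow (by positivity) (by positivity),
        ← Real.mul_rpow (by positivity) (by positivity)]
      congr 1
      ring
    have hpow : t * t ^ κ ≤ 2 ^ (1 + κ) * max 1 ‖x‖ ^ (1 + κ) := by
      rw [← Real.mul_rpow zero_le_two (by positivity)]
      calc t * t ^ κ = t ^ (1 + κ) := by rw [Real.rpow_add ht0, Real.rpow_one]
        _ ≤ _ := by gcongr
    rw [hsplit]
    calc 3 * t * ((c / 2) ^ (-(1 / d : ℝ)) * (n : ℝ) ^ (-(1 / d : ℝ)) * t ^ κ)
        = 3 * (c / 2) ^ (-(1 / d : ℝ)) * (n : ℝ) ^ (-(1 / d : ℝ)) * (t * t ^ κ) := by ring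
      _ ≤ 3 * (c / 2) ^ (-(1 / d : ℝ)) * (n : ℝ) ^ (-(1 / d : ℝ))
          * (2 ^ (1 + κ) * max 1 ‖x‖ ^ (1 + κ)) := by gcongr
      _ = _ := by ring

/-- Pierce's lemma: a finite moment of order `r + η` gives the rate `n^{-r/d}` for the `L^r`
quantization error. -/
lemma exists_qerr_le {d : ℕ} (hd : 1 ≤ d) {r η : ℝ} (hr : 0 < r) (hη : 0 < η)
    (P : Measure (EuclideanSpace ℝ (Fin d))) [IsProbabilityMeasure P]
    (hmom : (∫⁻ x, ENNReal.ofReal ‖x‖ ^ (r + η) ∂P) ≠ ⊤) :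
    ∃ C > (0 : ℝ), ∀ n : ℕ, 1 ≤ n → ∃ β : Finset (EuclideanSpace ℝ (Fin d)),
      β.Nonempty ∧ β.card ≤ n ∧ qerr P r β ≤ ENNReal.ofReal (C * (n : ℝ) ^ (-(r / d))) := by
  obtain ⟨C, hC, h⟩ := exists_codebook_qdist_le hd (by positivity : 0 < η / r)
  set I := ∫⁻ x, ENNReal.ofReal ‖x‖ ^ (r + η) ∂P
  refine ⟨C ^ r * (1 + I.toReal), by positivity, fun n hn => ?_⟩
  obtain ⟨β, hβ, hcard, hdist⟩ := h n hn
  refine ⟨β, hβ, hcard, ?_⟩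
  have hn0 : (0 : ℝ) < n := by exact_mod_cast hn
  have hpt : ∀ x, ENNReal.ofReal (qdist x β) ^ r ≤
      ENNReal.ofReal (C ^ r * (n : ℝ) ^ (-(r / d))) * (1 + ENNReal.ofReal ‖x‖ ^ (r + η)) := by
    intro x
    rw [ENNReal.ofReal_rpow_of_nonneg (qdist_nonneg _ _) hr.le,
      ENNReal.ofReal_rpow_of_nonneg (norm_nonneg x) (by positivity), ← ENNReal.ofReal_one,
      ← ENNReal.ofReal_add zero_le_one (by positivity), ← ENNReal.ofReal_mul (by positivity)]
    refine ENNReal.ofReal_le_ofReal ?_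
    have hmax : max 1 ‖x‖ ^ (r + η) ≤ 1 + ‖x‖ ^ (r + η) := by
      rcases max_cases 1 ‖x‖ with ⟨h, _⟩ | ⟨h, _⟩ <;> rw [h]
      · rw [Real.one_rpow]
        linarith [Real.rpow_nonneg (norm_nonneg x) (r + η)]
      · linarith
    calc qdist x β ^ r ≤ (C * (n : ℝ) ^ (-(1 / d : ℝ)) * max 1 ‖x‖ ^ (1 + η / r)) ^ r :=
          Real.rpow_le_rpow (qdist_nonneg _ _) (hdist x) hr.le
      _ = C ^ r * (n : ℝ) ^ (-(r / d)) * max 1 ‖x‖ ^ (r + η) := by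
          rw [Real.mul_rpow (by positivity) (by positivity),
            Real.mul_rpow (by positivity) (by positivity), ← Real.rpow_mul hn0.le,
            ← Real.rpow_mul (by positivity)]
          congr 2
          · congr 1
            ring
          · field_simp
      _ ≤ _ := by gcongr
  calc qerr P r β ≤ ∫⁻ x, ENNReal.ofReal (C ^ r * (n : ℝ) ^ (-(r / d)))
        * (1 + ENNReal.ofReal ‖x‖ ^ (r + η)) ∂P := lintegral_mono hpt
    _ = ENNReal.ofReal (C ^ r * (n : ℝ) ^ (-(r / d))) * (1 + I) := by
        rw [lintegral_const_mul' _ _ ENNReal.ofReal_ne_top, lintegral_add_left measurable_const]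
        simp [I]
    _ = _ := by
        rw [← ENNReal.ofReal_toReal hmom, ← ENNReal.ofReal_one,
          ← ENNReal.ofReal_add zero_le_one ENNReal.toReal_nonneg,
          ← ENNReal.ofReal_mul (by positivity), ENNReal.ofReal_toReal hmom]
        congr 1
        ring

lemma OptimalSeq.qerr_le {d : ℕ} {P : Measure (EuclideanSpace ℝ (Fin d))} {r : ℝ} (hr : 0 < r)
    {α : ℕ → Finset (EuclideanSpace ℝ (Fin d))} (hα : OptimalSeq P r α) {n : ℕ} (hn : 1 ≤ n)
    {β : Finset (EuclideanSpace ℝ (Fin d))} (hβ : β.Nonempty) (hcard : β.card ≤ n) :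
    qerr P r (α n) ≤ qerr P r β := by
  rw [(hα n hn).2.2]
  calc enr P r n ^ r ≤ (qerr P r β ^ (1 / r)) ^ r := by
        refine ENNReal.rpow_le_rpow ?_ hr.le
        exact iInf_le_of_le β (iInf_le_of_le hβ (iInf_le_of_le hcard le_rfl))
    _ = qerr P r β := by rw [← ENNReal.rpow_mul, one_div_mul_cancel hr.ne', ENNReal.rpow_one]

/-- The nearest point of a nonempty codebook is attained. -/
lemma exists_mem_qdist_eq {d : ℕ} {α : Finset (EuclideanSpace ℝ (Fin d))} (hα : α.Nonempty)
    (x : EuclideanSpace ℝ (Fin d)) : ∃ a ∈ α, qdist x α = dist x a := by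
  obtain ⟨a, ha, h⟩ := α.finite_toSet.isCompact.exists_infDist_eq_dist (by simpa using hα) x
  exact ⟨a, by simpa using ha, h⟩

lemma ENNReal.add_rpow_le_two_rpow_mul {r : ℝ} (hr : 0 < r) (u v : ℝ≥0∞) :
    (u + v) ^ r ≤ 2 ^ r * (u ^ r + v ^ r) := by
  rcases le_total u v with h | h
  · calc (u + v) ^ r ≤ (2 * v) ^ r := by
          refine ENNReal.rpow_le_rpow ?_ hr.le
          rw [two_mul]
          gcongr
      _ = 2 ^ r * v ^ r := ENNReal.mul_rpow_of_nonneg _ _ hr.le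
      _ ≤ _ := by
          gcongr
          exact le_add_self
  · calc (u + v) ^ r ≤ (2 * u) ^ r := by
          refine ENNReal.rpow_le_rpow ?_ hr.le
          rw [two_mul]
          gcongr
      _ = 2 ^ r * u ^ r := ENNReal.mul_rpow_of_nonneg _ _ hr.le
      _ ≤ _ := by
          gcongr
          exact le_self_add

/-- A density charges a bounded set of positive Lebesgue measure on which it is bounded below. -/
lemma exists_bounded_set_density_ge {d : ℕ} {f : EuclideanSpace ℝ (Fin d) → ℝ} (hfm : Measurable f)
    {P : Measure (EuclideanSpace ℝ (Fin d))} [IsProbabilityMeasure P]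
    (hP : P = volume.withDensity fun x => ENNReal.ofReal (f x)) :
    ∃ R > (0 : ℝ), ∃ c > (0 : ℝ), ∃ G : Set (EuclideanSpace ℝ (Fin d)), MeasurableSet G ∧
      0 < volume G ∧ (∀ x ∈ G, ‖x‖ ≤ R) ∧ ∀ x ∈ G, c ≤ f x := by
  let G : ℕ → Set (EuclideanSpace ℝ (Fin d)) := fun k =>
    {x | ‖x‖ ≤ (k : ℝ) + 1} ∩ {x | 1 / ((k : ℝ) + 1) ≤ f x}
  obtain ⟨k, hk⟩ : ∃ k, 0 < volume (G k) := by
    by_contra! h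
    have hnull : volume (⋃ k, G k) = 0 :=
      measure_iUnion_null fun k => le_antisymm (h k) zero_le
    have hsub : {x | 0 < f x} ⊆ ⋃ k, G k := by
      intro x hx
      obtain ⟨k₁, h₁⟩ := exists_nat_one_div_lt (show 0 < f x from hx)
      obtain ⟨k₂, h₂⟩ := exists_nat_ge ‖x‖
      have e₁ : (k₁ : ℝ) ≤ (max k₁ k₂ : ℕ) := by exact_mod_cast le_max_left _ _
      have e₂ : (k₂ : ℝ) ≤ (max k₁ k₂ : ℕ) := by exact_mod_cast le_max_right _ _
      refine mem_iUnion.2 ⟨max k₁ k₂, ?_, ?_⟩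
      · change ‖x‖ ≤ _
        linarith
      · refine le_trans ?_ h₁.le
        gcongr
    have hae : (fun x => ENNReal.ofReal (f x)) =ᵐ[volume] 0 := by
      have : ∀ᵐ x ∂(volume : Measure (EuclideanSpace ℝ (Fin d))), ¬ 0 < f x :=
        measure_mono_null (fun x hx => hsub (not_not.1 hx)) hnull
      filter_upwards [this] with x hx
      simpa using hx
    have h1 : P univ = 0 := by
      rw [hP, withDensity_congr_ae hae]
      simp
    simp at h1
  exact ⟨k + 1, by positivity, 1 / (k + 1), by positivity, G k,
    (measurableSet_le measurable_norm measurable_const).inter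
      (measurableSet_le measurable_const hfm), hk, fun x hx => hx.1, fun x hx => hx.2⟩

/-- A sequence of codebooks with the rate `n^{-r/d}` has at least `c n` points in some ball. -/
lemma exists_card_filter_ge {d : ℕ} (hd : 1 ≤ d) {r : ℝ} (hr : 0 < r)
    {f : EuclideanSpace ℝ (Fin d) → ℝ} (hfm : Measurable f)
    {P : Measure (EuclideanSpace ℝ (Fin d))} [IsProbabilityMeasure P]
    (hP : P = volume.withDensity fun x => ENNReal.ofReal (f x))
    {α : ℕ → Finset (EuclideanSpace ℝ (Fin d))} (hα : ∀ n, 1 ≤ n → (α n).Nonempty)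
    {C : ℝ} (hC : 0 < C)
    (hrate : ∀ n : ℕ, 1 ≤ n → qerr P r (α n) ≤ ENNReal.ofReal (C * (n : ℝ) ^ (-(r / d)))) :
    ∃ R > (0 : ℝ), ∃ c > (0 : ℝ), ∀ᶠ n : ℕ in atTop,
      c * n ≤ ((α n).filter fun a => ‖a‖ ≤ R).card := by
  have hd0 : (0 : ℝ) < d := by exact_mod_cast hd
  obtain ⟨R, hR, c₀, hc₀, G, hGm, hG0, hGR, hGf⟩ := exists_bounded_set_density_ge hfm hP
  have hGtop : volume G ≠ ⊤ := by
    refine ((measure_mono fun x hx => ?_).trans_lt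
      (measure_closedBall_lt_top (x := (0 : EuclideanSpace ℝ (Fin d))) (r := R))).ne
    simpa using hGR x hx
  set g := (volume G).toReal with hg
  have hg0 : 0 < g := ENNReal.toReal_pos hG0.ne' hGtop
  set ω := (volume (ball (0 : EuclideanSpace ℝ (Fin d)) 1)).toReal with hω
  have hω0 : 0 < ω := ENNReal.toReal_pos (measure_ball_pos _ _ zero_lt_one).ne'
    measure_ball_lt_top.ne
  set κ : ℝ := (4 * C / (c₀ * g)) ^ (1 / r) with hκ
  have hκ0 : 0 < κ := by positivity
  have hκr : κ ^ r = 4 * C / (c₀ * g) := by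
    rw [hκ, ← Real.rpow_mul (by positivity), one_div_mul_cancel hr.ne', Real.rpow_one]
  refine ⟨R + 1, by linarith, g / (2 * ω * κ ^ d), by positivity, ?_⟩
  have hlim : Tendsto (fun n : ℕ => κ * (n : ℝ) ^ (-(1 / d : ℝ))) atTop (𝓝 (κ * 0)) :=
    ((tendsto_rpow_neg_atTop (by positivity)).comp tendsto_natCast_atTop_atTop).const_mul κ
  rw [mul_zero] at hlim
  filter_upwards [hlim.eventually_lt_const zero_lt_one, eventually_ge_atTop 1] with n ht1 hn
  have hn0 : (0 : ℝ) < n := by exact_mod_cast hn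
  set t : ℝ := κ * (n : ℝ) ^ (-(1 / d : ℝ)) with ht
  have ht0 : 0 < t := by positivity
  have htd : t ^ d = κ ^ d * (n : ℝ)⁻¹ := by
    rw [ht, mul_pow, ← Real.rpow_natCast ((n : ℝ) ^ _), ← Real.rpow_mul hn0.le,
      ← Real.rpow_neg_one]
    congr 2
    field_simp
  have htr : t ^ r = κ ^ r * (n : ℝ) ^ (-(r / d)) := by
    rw [ht, Real.mul_rpow hκ0.le (by positivity), ← Real.rpow_mul hn0.le]
    congr 2
    ring
  by_contra! hlt
  set T := (α n).filter fun a => ‖a‖ ≤ R + 1 with hT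
  set S := G ∩ {x | t ≤ qdist x (α n)} with hS
  have hSm : MeasurableSet S := hGm.inter (measurableSet_le measurable_const (measurable_qdist _))
  have hcover : G ⊆ S ∪ ⋃ a ∈ T, ball a t := by
    intro x hx
    by_cases h : t ≤ qdist x (α n)
    · exact Or.inl ⟨hx, h⟩
    · right
      obtain ⟨a, ha, hxa⟩ := exists_mem_qdist_eq (hα n hn) x
      rw [not_le, hxa] at h
      refine mem_iUnion₂.2 ⟨a, Finset.mem_filter.2 ⟨ha, ?_⟩, h⟩
      have h1 := norm_le_norm_add_norm_sub' a x
      have h2 := hGR x hx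
      rw [← dist_eq_norm, dist_comm] at h1
      linarith
  have hSle : ENNReal.ofReal (g / 2) ≤ volume S := by
    have h1 : volume G ≤ volume S + ENNReal.ofReal (g / 2) := by
      refine (measure_mono hcover).trans ((measure_union_le _ _).trans ?_)
      gcongr
      refine (measure_biUnion_finset_le _ _).trans ?_
      simp only [Measure.addHaar_ball_of_pos _ _ ht0, Finset.sum_const, nsmul_eq_mul,
        finrank_euclideanSpace_fin]
      rw [← ENNReal.ofReal_toReal (measure_ball_lt_top (x := (0 : EuclideanSpace ℝ (Fin d)))).ne,
        ← hω, ← ENNReal.ofReal_natCast, ← ENNReal.ofReal_mul (by positivity),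
        ← ENNReal.ofReal_mul (by positivity)]
      refine ENNReal.ofReal_le_ofReal ?_
      calc (T.card : ℝ) * (t ^ d * ω) ≤ g / (2 * ω * κ ^ d) * n * (t ^ d * ω) := by gcongr
        _ = g / 2 := by
          rw [htd]
          field_simp
    rw [← ENNReal.ofReal_toReal hGtop, ← hg] at h1
    have h2 : ENNReal.ofReal g = ENNReal.ofReal (g / 2) + ENNReal.ofReal (g / 2) := by
      rw [← ENNReal.ofReal_add (by positivity) (by positivity), add_halves]
    rw [h2] at h1
    exact (ENNReal.add_le_add_iff_right ENNReal.ofReal_ne_top).1 h1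
  have hPS : ENNReal.ofReal (c₀ * (g / 2)) ≤ P S := by
    rw [hP, withDensity_apply _ hSm, ENNReal.ofReal_mul hc₀.le]
    calc ENNReal.ofReal c₀ * ENNReal.ofReal (g / 2) ≤ ENNReal.ofReal c₀ * volume S := by gcongr
      _ = ∫⁻ _ in S, ENNReal.ofReal c₀ := by rw [setLIntegral_const]
      _ ≤ _ := setLIntegral_mono (by fun_prop) fun x hx => ENNReal.ofReal_le_ofReal (hGf x hx.1)
  have hlow : ENNReal.ofReal (t ^ r * (c₀ * (g / 2))) ≤ qerr P r (α n) := by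
    rw [ENNReal.ofReal_mul (by positivity)]
    calc ENNReal.ofReal (t ^ r) * ENNReal.ofReal (c₀ * (g / 2)) ≤ ENNReal.ofReal (t ^ r) * P S := by
          gcongr
      _ = ∫⁻ _ in S, ENNReal.ofReal (t ^ r) ∂P := by rw [setLIntegral_const]
      _ ≤ ∫⁻ x in S, ENNReal.ofReal (qdist x (α n)) ^ r ∂P := by
          refine setLIntegral_mono
            ((measurable_qdist _).ennreal_ofReal.pow_const r) fun x hx => ?_
          rw [ENNReal.ofReal_rpow_of_nonneg (qdist_nonneg _ _) hr.le]
          exact ENNReal.ofReal_le_ofReal (Real.rpow_le_rpow ht0.le hx.2 hr.le)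
      _ ≤ _ := setLIntegral_le_lintegral _ _
  have hfin := (ENNReal.ofReal_le_ofReal_iff (by positivity)).1 (hlow.trans (hrate n hn))
  have : t ^ r * (c₀ * (g / 2)) = 2 * (C * (n : ℝ) ^ (-(r / d))) := by
    rw [htr, hκr]
    field_simp
    ring
  have hpos : 0 < C * (n : ℝ) ^ (-(r / d)) := by positivity
  linarith

/-- Deleting a well chosen point among those of `T`, all having a neighbour at distance at most `δ`
in the codebook, increases the error by at most the average of the local errors. -/
lemma exists_qerr_erase_le {d : ℕ} {r : ℝ} (hr : 0 < r)
    (P : Measure (EuclideanSpace ℝ (Fin d))) [IsProbabilityMeasure P]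
    {α T : Finset (EuclideanSpace ℝ (Fin d))} (hT : T.Nonempty) (hTα : T ⊆ α) {δ : ℝ} (hδ : 0 ≤ δ)
    (hnear : ∀ a ∈ T, ∃ a' ∈ α, a' ≠ a ∧ dist a a' ≤ δ) :
    ∃ a ∈ T, (α.erase a).Nonempty ∧
      qerr P r (α.erase a) ≤
        qerr P r α + 2 ^ r * (qerr P r α + ENNReal.ofReal δ ^ r) / T.card := by
  let U : EuclideanSpace ℝ (Fin d) → Set (EuclideanSpace ℝ (Fin d)) :=
    fun a => {x | dist x a < qdist x (α.erase a)}
  have hUm : ∀ a, MeasurableSet (U a) := fun a =>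
    measurableSet_lt (measurable_id.dist measurable_const) (measurable_qdist _)
  have hUd : Set.PairwiseDisjoint (T : Set (EuclideanSpace ℝ (Fin d))) U := by
    intro a ha a' ha' hne
    refine Set.disjoint_left.2 fun x hx hx' => ?_
    have h1 : qdist x (α.erase a) ≤ dist x a' :=
      qdist_le_dist (Finset.mem_erase.2 ⟨hne.symm, hTα ha'⟩)
    have h2 : qdist x (α.erase a') ≤ dist x a := qdist_le_dist (Finset.mem_erase.2 ⟨hne, hTα ha⟩)
    have h3 : dist x a < qdist x (α.erase a) := hx
    have h4 : dist x a' < qdist x (α.erase a') := hx'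
    linarith
  let h : EuclideanSpace ℝ (Fin d) → ℝ≥0∞ :=
    fun x => 2 ^ r * (ENNReal.ofReal (qdist x α) ^ r + ENNReal.ofReal δ ^ r)
  have hqm : Measurable fun x => ENNReal.ofReal (qdist x α) ^ r :=
    (measurable_qdist α).ennreal_ofReal.pow_const r
  have hint : ∫⁻ x, h x ∂P = 2 ^ r * (qerr P r α + ENNReal.ofReal δ ^ r) := by
    rw [lintegral_const_mul' _ _ (ENNReal.rpow_ne_top_of_nonneg hr.le ENNReal.ofNat_ne_top),
      lintegral_add_left hqm]
    simp [qerr]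
  have hsum : ∑ a ∈ T, ∫⁻ x in U a, h x ∂P ≤ 2 ^ r * (qerr P r α + ENNReal.ofReal δ ^ r) := by
    rw [← lintegral_biUnion_finset hUd fun a _ => hUm a, ← hint]
    exact setLIntegral_le_lintegral _ _
  obtain ⟨a, ha, hmin⟩ := T.exists_min_image (fun a => ∫⁻ x in U a, h x ∂P) hT
  obtain ⟨a', ha', hne, hdist⟩ := hnear a ha
  have ha'e : a' ∈ α.erase a := Finset.mem_erase.2 ⟨hne, ha'⟩
  refine ⟨a, ha, ⟨a', ha'e⟩, ?_⟩
  have hle : ∫⁻ x in U a, h x ∂P ≤ 2 ^ r * (qerr P r α + ENNReal.ofReal δ ^ r) / T.card := by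
    rw [ENNReal.le_div_iff_mul_le (Or.inl (by simpa using hT.ne_empty))
      (Or.inl (ENNReal.natCast_ne_top _)), mul_comm, ← nsmul_eq_mul]
    exact (Finset.card_nsmul_le_sum _ _ _ hmin).trans hsum
  have hpt : ∀ x, ENNReal.ofReal (qdist x (α.erase a)) ^ r ≤
      ENNReal.ofReal (qdist x α) ^ r + (U a).indicator h x := by
    intro x
    obtain ⟨y, hy, hxy⟩ := exists_mem_qdist_eq ⟨a, hTα ha⟩ x
    by_cases hx : x ∈ U a
    · rw [indicator_of_mem hx]
      have hxa : dist x a ≤ qdist x α := by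
        by_cases hya : y = a
        · rw [hxy, hya]
        · have h1 : qdist x (α.erase a) ≤ dist x y := qdist_le_dist (Finset.mem_erase.2 ⟨hya, hy⟩)
          have h2 : dist x a < qdist x (α.erase a) := hx
          linarith
      have hx' : qdist x (α.erase a) ≤ qdist x α + δ :=
        (qdist_le_dist ha'e).trans ((dist_triangle _ a _).trans (add_le_add hxa hdist))
      calc ENNReal.ofReal (qdist x (α.erase a)) ^ r
          ≤ (ENNReal.ofReal (qdist x α) + ENNReal.ofReal δ) ^ r := by
            rw [← ENNReal.ofReal_add (qdist_nonneg _ _) hδ]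
            exact ENNReal.rpow_le_rpow (ENNReal.ofReal_le_ofReal hx') hr.le
        _ ≤ h x := ENNReal.add_rpow_le_two_rpow_mul hr _ _
        _ ≤ _ := le_add_self
    · rw [indicator_of_notMem hx, add_zero]
      refine ENNReal.rpow_le_rpow (ENNReal.ofReal_le_ofReal ?_) hr.le
      by_cases hya : y = a
      · rw [hxy, hya]
        exact not_lt.1 hx
      · rw [hxy]
        exact qdist_le_dist (Finset.mem_erase.2 ⟨hya, hy⟩)
  calc qerr P r (α.erase a)
      ≤ ∫⁻ x, (ENNReal.ofReal (qdist x α) ^ r + (U a).indicator h x) ∂P := lintegral_mono hpt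
    _ = qerr P r α + ∫⁻ x in U a, h x ∂P := by
        rw [lintegral_add_left hqm, lintegral_indicator (hUm a)]
        rfl
    _ ≤ _ := by gcongr

/-- In a codebook with at least `c n` points in a ball of radius `R`, at least `c n / 2` points of
this ball have a neighbour at distance of order `n^{-1/d}`. -/
lemma card_filter_near_ge {d : ℕ} (hd : 1 ≤ d) {R c : ℝ} (hR : 0 < R) (hc : 0 < c) {n : ℕ}
    (hn : 1 ≤ n) {δ : ℝ} (hδ : δ = 3 * R * (2 / c) ^ (1 / d : ℝ) * (n : ℝ) ^ (-(1 / d : ℝ)))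
    (hδR : δ ≤ R) (α : Finset (EuclideanSpace ℝ (Fin d)))
    (hα : c * n ≤ (α.filter fun a => ‖a‖ ≤ R).card) :
    c * n / 2 ≤ (α.filter fun a => ‖a‖ ≤ R ∧ ∃ a' ∈ α, a' ≠ a ∧ dist a a' ≤ δ).card := by
  have hd0 : (0 : ℝ) < d := by exact_mod_cast hd
  have hn0 : (0 : ℝ) < n := by exact_mod_cast hn
  have hδ0 : 0 < δ := by rw [hδ]; positivity
  set I := α.filter fun a => ‖a‖ ≤ R ∧ ¬ ∃ a' ∈ α, a' ≠ a ∧ dist a a' ≤ δ with hI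
  have hIcard : (I.card : ℝ) ≤ c * n / 2 := by
    have h1 : (I.card : ℝ) ≤ (1 + 2 * R / δ) ^ d := by
      refine card_le_of_dist_ge hR.le hδ0 I (fun a ha => (Finset.mem_filter.1 ha).2.1) ?_
      intro a ha a' ha' hne
      by_contra! h
      exact (Finset.mem_filter.1 ha).2.2 ⟨a', (Finset.mem_filter.1 ha').1, hne.symm, h.le⟩
    have h2 : 1 + 2 * R / δ ≤ 3 * R / δ := by
      rw [← sub_nonneg]
      have : 3 * R / δ - (1 + 2 * R / δ) = (R - δ) / δ := by
        field_simp
        ring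
      rw [this]
      exact div_nonneg (by linarith) hδ0.le
    have h3 : (3 * R / δ) ^ d = c * n / 2 := by
      have hpow : ∀ z : ℝ, 0 < z → (z ^ (1 / d : ℝ)) ^ d = z := fun z hz => by
        rw [← Real.rpow_natCast, ← Real.rpow_mul hz.le, one_div_mul_cancel hd0.ne', Real.rpow_one]
      rw [hδ, Real.rpow_neg hn0.le, div_pow, mul_pow, mul_pow, mul_pow, inv_pow,
        hpow _ (by positivity), hpow _ hn0]
      field_simp
      rw [mul_pow]
    calc (I.card : ℝ) ≤ (1 + 2 * R / δ) ^ d := h1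
      _ ≤ (3 * R / δ) ^ d := by gcongr
      _ = _ := h3
  have hsplit : (α.filter fun a => ‖a‖ ≤ R).card =
      (α.filter fun a => ‖a‖ ≤ R ∧ ∃ a' ∈ α, a' ≠ a ∧ dist a a' ≤ δ).card + I.card := by
    rw [hI, ← Finset.filter_filter, ← Finset.filter_filter]
    exact (Finset.card_filter_add_card_filter_not _).symm
  rw [hsplit] at hα
  push_cast at hα
  linarith

/-- The increments of the optimal `L^r` errors are `O(n^{-(1+r/d)})`. -/
lemma OptimalSeq.exists_qerr_le_succ_add {d : ℕ} (hd : 1 ≤ d) {r : ℝ} (hr : 0 < r)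
    {f : EuclideanSpace ℝ (Fin d) → ℝ} (hfm : Measurable f)
    {P : Measure (EuclideanSpace ℝ (Fin d))} [IsProbabilityMeasure P]
    (hP : P = volume.withDensity fun x => ENNReal.ofReal (f x))
    {α : ℕ → Finset (EuclideanSpace ℝ (Fin d))} (hα : OptimalSeq P r α)
    {C : ℝ} (hC : 0 < C)
    (hrate : ∀ n : ℕ, 1 ≤ n → qerr P r (α n) ≤ ENNReal.ofReal (C * (n : ℝ) ^ (-(r / d)))) :
    ∃ C' > (0 : ℝ), ∀ᶠ n : ℕ in atTop,
      qerr P r (α n) ≤ qerr P r (α (n + 1)) + ENNReal.ofReal (C' * (n : ℝ) ^ (-(1 + r / d))) := by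
  have hd0 : (0 : ℝ) < d := by exact_mod_cast hd
  obtain ⟨R, hR, c, hc, hcard⟩ :=
    exists_card_filter_ge hd hr hfm hP (fun n hn => (hα n hn).1) hC hrate
  set K : ℝ := 3 * R * (2 / c) ^ (1 / d : ℝ) with hK
  have hK0 : 0 < K := by positivity
  have hlim : Tendsto (fun n : ℕ => K * (n : ℝ) ^ (-(1 / d : ℝ))) atTop (𝓝 (K * 0)) :=
    ((tendsto_rpow_neg_atTop (by positivity)).comp tendsto_natCast_atTop_atTop).const_mul K
  rw [mul_zero] at hlim
  refine ⟨2 ^ r * (C + K ^ r) * (2 / c), by positivity, ?_⟩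
  have hev := ((hlim.eventually_lt_const hR).and hcard).and (eventually_ge_atTop 1)
  filter_upwards [(tendsto_add_atTop_nat 1).eventually hev, eventually_ge_atTop 1]
    with m ⟨⟨hδR, hcn⟩, hn⟩ hm
  have hm0 : (0 : ℝ) < m := by exact_mod_cast hm
  set n := m + 1 with hnm
  have hmn : (m : ℝ) ≤ n := by exact_mod_cast Nat.le_succ m
  have hn0 : (0 : ℝ) < n := by linarith
  set δ : ℝ := K * (n : ℝ) ^ (-(1 / d : ℝ)) with hδ
  have hδ0 : 0 < δ := by positivity
  set T := (α n).filter fun a => ‖a‖ ≤ R ∧ ∃ a' ∈ α n, a' ≠ a ∧ dist a a' ≤ δ with hTdef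
  have hT : c * n / 2 ≤ T.card := card_filter_near_ge hd hR hc hn hδ hδR.le (α n) hcn
  have hT0 : (0 : ℝ) < T.card := lt_of_lt_of_le (by positivity) hT
  obtain ⟨a, ha, hne, hle⟩ := exists_qerr_erase_le (α := α n) (T := T) hr P
    (Finset.card_pos.1 (by exact_mod_cast hT0))
    (Finset.filter_subset _ _) hδ0.le fun a ha => (Finset.mem_filter.1 ha).2.2
  have hecard : ((α n).erase a).card ≤ m := by
    have h1 := (hα n hn).2.1
    rw [Finset.card_erase_of_mem (Finset.mem_filter.1 ha).1]
    omega
  refine (hα.qerr_le hr hm hne hecard).trans (hle.trans ?_)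
  gcongr
  have hδr : δ ^ r = K ^ r * (n : ℝ) ^ (-(r / d)) := by
    rw [hδ, Real.mul_rpow hK0.le (by positivity), ← Real.rpow_mul hn0.le]
    congr 2
    ring
  have h2 : (2 : ℝ≥0∞) ^ r = ENNReal.ofReal (2 ^ r) := by
    rw [← ENNReal.ofReal_rpow_of_pos two_pos, ENNReal.ofReal_ofNat]
  calc 2 ^ r * (qerr P r (α n) + ENNReal.ofReal δ ^ r) / T.card
      ≤ 2 ^ r * (ENNReal.ofReal (C * (n : ℝ) ^ (-(r / d)))
          + ENNReal.ofReal (K ^ r * (n : ℝ) ^ (-(r / d)))) / ENNReal.ofReal (c * n / 2) := by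
        rw [ENNReal.ofReal_rpow_of_pos hδ0, hδr]
        refine ENNReal.div_le_div ?_ ?_
        · gcongr
          exact hrate n hn
        · rw [← ENNReal.ofReal_natCast]
          exact ENNReal.ofReal_le_ofReal hT
    _ = ENNReal.ofReal (2 ^ r * (C + K ^ r) * (2 / c) * (n : ℝ) ^ (-(1 + r / d))) := by
        rw [h2, ← ENNReal.ofReal_add (by positivity) (by positivity),
          ← ENNReal.ofReal_mul (by positivity), ← ENNReal.ofReal_div_of_pos (by positivity)]
        congr 1
        rw [neg_add, Real.rpow_add hn0, Real.rpow_neg_one]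
        field_simp
    _ ≤ _ := by
        refine ENNReal.ofReal_le_ofReal (mul_le_mul_of_nonneg_left ?_ (by positivity))
        refine Real.rpow_le_rpow_of_nonpos hm0 hmn ?_
        rw [neg_nonpos]
        positivity

/-- Insertion inequality: adding the point `ξ` to an optimal codebook. -/
lemma OptimalSeq.qerr_succ_add_le {d : ℕ} {r : ℝ} (hr : 0 < r)
    {P : Measure (EuclideanSpace ℝ (Fin d))}
    {α : ℕ → Finset (EuclideanSpace ℝ (Fin d))} (hα : OptimalSeq P r α) {b : ℝ}
    (hb : b ∈ Ioo (0 : ℝ) (1 / 2)) {n : ℕ} (hn : 1 ≤ n) (ξ : EuclideanSpace ℝ (Fin d)) :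
    qerr P r (α (n + 1)) + ENNReal.ofReal (((1 - b) ^ r - b ^ r) * qdist ξ (α n) ^ r)
        * P (ball ξ (b * qdist ξ (α n))) ≤ qerr P r (α n) := by
  obtain ⟨hb0, hb1⟩ := hb
  set D := qdist ξ (α n) with hD
  have hD0 : 0 ≤ D := qdist_nonneg _ _
  set B := ball ξ (b * D)
  set v := ENNReal.ofReal (((1 - b) ^ r - b ^ r) * D ^ r) with hv
  have hpt : ∀ x, ENNReal.ofReal (qdist x (insert ξ (α n))) ^ r + B.indicator (fun _ => v) x
      ≤ ENNReal.ofReal (qdist x (α n)) ^ r := by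
    intro x
    by_cases hx : x ∈ B
    · have hxξ : dist x ξ < b * D := hx
      have h1 : qdist x (insert ξ (α n)) ≤ b * D :=
        (qdist_le_dist (Finset.mem_insert_self _ _)).trans hxξ.le
      have h2 : (1 - b) * D ≤ qdist x (α n) := by
        have h3 : D ≤ qdist x (α n) + dist ξ x := infDist_le_infDist_add_dist
        rw [dist_comm] at h3
        linarith
      have hpow : b ^ r ≤ (1 - b) ^ r := Real.rpow_le_rpow hb0.le (by linarith) hr.le
      rw [indicator_of_mem hx, ENNReal.ofReal_rpow_of_nonneg (qdist_nonneg _ _) hr.le,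
        ENNReal.ofReal_rpow_of_nonneg (qdist_nonneg _ _) hr.le, hv, ← ENNReal.ofReal_add
          (Real.rpow_nonneg (qdist_nonneg _ _) _)
          (mul_nonneg (sub_nonneg.2 hpow) (Real.rpow_nonneg hD0 _))]
      refine ENNReal.ofReal_le_ofReal ?_
      have h4 := Real.rpow_le_rpow (qdist_nonneg _ _) h1 hr.le
      have h5 := Real.rpow_le_rpow (mul_nonneg (by linarith) hD0) h2 hr.le
      rw [Real.mul_rpow hb0.le hD0] at h4
      rw [Real.mul_rpow (by linarith) hD0] at h5
      linarith
    · rw [indicator_of_notMem hx, add_zero]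
      refine ENNReal.rpow_le_rpow (ENNReal.ofReal_le_ofReal ?_) hr.le
      exact infDist_le_infDist_of_subset (by simp) (by simpa using (hα n hn).1)
  calc qerr P r (α (n + 1)) + v * P B ≤ qerr P r (insert ξ (α n)) + v * P B := by
        gcongr
        refine hα.qerr_le hr (by omega) (Finset.insert_nonempty _ _) ?_
        exact (Finset.card_insert_le _ _).trans (Nat.succ_le_succ (hα n hn).2.1)
    _ = ∫⁻ x, (ENNReal.ofReal (qdist x (insert ξ (α n))) ^ r + B.indicator (fun _ => v) x) ∂P := by
        rw [lintegral_add_right _ (measurable_const.indicator measurableSet_ball),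
          lintegral_indicator measurableSet_ball, setLIntegral_const]
        rfl
    _ ≤ _ := lintegral_mono hpt

/-- The pointwise mismatch bound: the maximal function controls the distance to the optimal
codebooks at the rate `n^{-1/d}`. -/
lemma OptimalSeq.exists_qdist_rpow_le_maxFun {d : ℕ} (hd : 1 ≤ d) {r s : ℝ} (hr : 0 < r)
    (hs : 0 < s) {P : Measure (EuclideanSpace ℝ (Fin d))} [IsProbabilityMeasure P]
    {α : ℕ → Finset (EuclideanSpace ℝ (Fin d))} (hα : OptimalSeq P r α) {b : ℝ}
    (hb : b ∈ Ioo (0 : ℝ) (1 / 2)) {C : ℝ} (hC : 0 < C)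
    (hfin : ∀ n : ℕ, 1 ≤ n → qerr P r (α n) ≠ ⊤)
    (hinc : ∀ᶠ n : ℕ in atTop,
      qerr P r (α n) ≤ qerr P r (α (n + 1)) + ENNReal.ofReal (C * (n : ℝ) ^ (-(1 + r / d)))) :
    ∃ M > (0 : ℝ), ∀ᶠ n : ℕ in atTop, ∀ ξ,
      ENNReal.ofReal (qdist ξ (α n)) ^ s ≤
        ENNReal.ofReal (M * (n : ℝ) ^ (-(s / d))) * maxFun P α b ξ ^ (s / ((d : ℝ) + r)) := by
  have hd0 : (0 : ℝ) < d := by exact_mod_cast hd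
  set ω := (volume (ball (0 : EuclideanSpace ℝ (Fin d)) 1)).toReal with hω
  have hω0 : 0 < ω := ENNReal.toReal_pos (measure_ball_pos _ _ zero_lt_one).ne'
    measure_ball_lt_top.ne
  obtain ⟨hb0, hb1⟩ := hb
  set A : ℝ := (1 - b) ^ r - b ^ r with hA
  have hA0 : 0 < A := sub_pos.2 (Real.rpow_lt_rpow hb0.le (by linarith) hr)
  refine ⟨(C / (ω * b ^ d * A)) ^ (s / (d + r)), by positivity, ?_⟩
  filter_upwards [hinc, eventually_ge_atTop 1] with n hn hn1 ξ
  have hn0 : (0 : ℝ) < n := by exact_mod_cast hn1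
  set D := qdist ξ (α n) with hD
  rcases (qdist_nonneg ξ (α n)).eq_or_lt with h0 | hD0
  · rw [hD, ← h0, ENNReal.ofReal_zero, ENNReal.zero_rpow_of_pos hs]
    exact zero_le
  rw [← hD] at hD0
  set ψ := maxFun P α b ξ with hψ
  have hexp : 0 < s / ((d : ℝ) + r) := by positivity
  rcases eq_or_ne ψ ⊤ with htop | htop
  · rw [htop, ENNReal.top_rpow_of_pos hexp, ENNReal.mul_top]
    · exact le_top
    · rw [Ne, ENNReal.ofReal_eq_zero, not_le]
      positivity
  set B := ball ξ (b * D) with hB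
  have hratio : volume B / P B ≤ ψ :=
    le_iSup₂_of_le (f := fun (n : ℕ) (_ : 1 ≤ n) => volume (ball ξ (b * qdist ξ (α n)))
      / P (ball ξ (b * qdist ξ (α n)))) n hn1 le_rfl
  have hvolB : volume B = ENNReal.ofReal (ω * (b * D) ^ d) := by
    rw [hB, Measure.addHaar_ball_of_pos _ _ (by positivity), finrank_euclideanSpace_fin,
      ← ENNReal.ofReal_toReal (measure_ball_lt_top (x := (0 : EuclideanSpace ℝ (Fin d)))).ne,
      ← hω, ← ENNReal.ofReal_mul (by positivity), mul_comm]
  have hvol0 : volume B ≠ 0 := (measure_ball_pos _ _ (by positivity)).ne'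
  have hPB : P B ≠ 0 := by
    intro h
    rw [h, ENNReal.div_zero hvol0] at hratio
    exact htop (top_le_iff.1 hratio)
  have hvol : volume B ≤ ψ * P B :=
    (ENNReal.div_le_iff hPB (measure_ne_top _ _)).1 hratio
  have hmass : ENNReal.ofReal (A * D ^ r) * P B ≤
      ENNReal.ofReal (C * (n : ℝ) ^ (-(1 + r / d))) := by
    have h := (hα.qerr_succ_add_le hr ⟨hb0, hb1⟩ hn1 ξ).trans hn
    exact (ENNReal.add_le_add_iff_left (hfin _ (by omega))).1 h
  have hpow : ENNReal.ofReal (D ^ (d + r)) ≤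
      ENNReal.ofReal (C / (ω * b ^ d * A) * (n : ℝ) ^ (-(1 + r / d))) * ψ := by
    have h1 : ENNReal.ofReal (A * D ^ r) * ENNReal.ofReal (ω * (b * D) ^ d) ≤
        ENNReal.ofReal (C * (n : ℝ) ^ (-(1 + r / d))) * ψ := by
      calc ENNReal.ofReal (A * D ^ r) * ENNReal.ofReal (ω * (b * D) ^ d)
          ≤ ENNReal.ofReal (A * D ^ r) * (ψ * P B) := by
            rw [← hvolB]
            gcongr
        _ = ENNReal.ofReal (A * D ^ r) * P B * ψ := by ring
        _ ≤ _ := by gcongr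
    have h2 : D ^ (d + r) = (ω * b ^ d * A)⁻¹ * (A * D ^ r * (ω * (b * D) ^ d)) := by
      rw [Real.rpow_add hD0, Real.rpow_natCast, mul_pow]
      field_simp
    have h3 : C / (ω * b ^ d * A) * (n : ℝ) ^ (-(1 + r / d)) =
        (ω * b ^ d * A)⁻¹ * (C * (n : ℝ) ^ (-(1 + r / d))) := by ring
    rw [h2, h3, ENNReal.ofReal_mul (by positivity), ENNReal.ofReal_mul (p := (ω * b ^ d * A)⁻¹)
      (by positivity), ENNReal.ofReal_mul (p := A * D ^ r) (by positivity), mul_assoc _ _ ψ]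
    exact mul_le_mul' le_rfl h1
  calc ENNReal.ofReal D ^ s = ENNReal.ofReal (D ^ (d + r)) ^ (s / (d + r)) := by
        rw [ENNReal.ofReal_rpow_of_pos hD0, ENNReal.ofReal_rpow_of_pos (by positivity),
          ← Real.rpow_mul hD0.le]
        congr 2
        field_simp
    _ ≤ (ENNReal.ofReal (C / (ω * b ^ d * A) * (n : ℝ) ^ (-(1 + r / d))) * ψ) ^ (s / (d + r)) :=
        ENNReal.rpow_le_rpow hpow hexp.le
    _ = _ := by
        rw [ENNReal.mul_rpow_of_nonneg _ _ hexp.le, ENNReal.ofReal_rpow_of_pos (by positivity),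
          Real.mul_rpow (by positivity) (by positivity), ← Real.rpow_mul hn0.le]
        congr 4
        field_simp

lemma qdist_dilate {d : ℕ} {θ : ℝ} (hθ : 0 < θ) (μ x : EuclideanSpace ℝ (Fin d))
    {α : Finset (EuclideanSpace ℝ (Fin d))} (hα : α.Nonempty) :
    qdist x (dilate α θ μ) = θ * qdist (μ + θ⁻¹ • (x - μ)) α := by
  have key : ∀ a, dist x (μ + θ • (a - μ)) = θ * dist (μ + θ⁻¹ • (x - μ)) a := by
    intro a
    have : x - (μ + θ • (a - μ)) = θ • (μ + θ⁻¹ • (x - μ) - a) := by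
      simp only [smul_sub, smul_add, smul_inv_smul₀ hθ.ne']
      abel
    rw [dist_eq_norm, this, norm_smul, Real.norm_of_nonneg hθ.le, dist_eq_norm]
  apply le_antisymm
  · obtain ⟨a, ha, h⟩ := exists_mem_qdist_eq hα (μ + θ⁻¹ • (x - μ))
    rw [h, ← key]
    exact qdist_le_dist (Finset.mem_image_of_mem _ ha)
  · obtain ⟨y, hy, h⟩ := exists_mem_qdist_eq (hα.image fun a => μ + θ • (a - μ)) x
    obtain ⟨a, ha, rfl⟩ := Finset.mem_image.1 hy
    rw [key] at h
    change _ ≤ qdist x (α.image fun a => μ + θ • (a - μ))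
    rw [h]
    exact mul_le_mul_of_nonneg_left (qdist_le_dist ha) hθ.le

lemma qerr_dilate {d : ℕ} {θ s : ℝ} (hθ : 0 < θ) (hs : 0 < s) (μ : EuclideanSpace ℝ (Fin d))
    (P : Measure (EuclideanSpace ℝ (Fin d))) {α : Finset (EuclideanSpace ℝ (Fin d))}
    (hα : α.Nonempty) :
    qerr P s (dilate α θ μ) = ENNReal.ofReal θ ^ s * qerr (Pdil P θ μ) s α := by
  rw [qerr, qerr, Pdil, lintegral_map ((measurable_qdist α).ennreal_ofReal.pow_const s)
    (by fun_prop), ← lintegral_const_mul' _ _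
      (ENNReal.rpow_ne_top_of_nonneg hs.le ENNReal.ofReal_ne_top)]
  refine lintegral_congr fun x => ?_
  rw [qdist_dilate hθ μ x hα, ENNReal.ofReal_mul hθ.le, ENNReal.mul_rpow_of_nonneg _ _ hs.le]

lemma Pdil_eq_smul_withDensity {d : ℕ} {θ : ℝ} (hθ : 0 < θ) (μ : EuclideanSpace ℝ (Fin d))
    {f : EuclideanSpace ℝ (Fin d) → ℝ} (hfm : Measurable f) :
    Pdil (volume.withDensity fun x => ENNReal.ofReal (f x)) θ μ =
      ENNReal.ofReal (θ ^ d) • volume.withDensity fun x => ENNReal.ofReal (fdil f θ μ x) := by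
  have hTm : Measurable fun x : EuclideanSpace ℝ (Fin d) => μ + θ⁻¹ • (x - μ) := by fun_prop
  have hFm : Measurable fun x => ENNReal.ofReal (fdil f θ μ x) :=
    (hfm.comp (by fun_prop : Measurable fun x => μ + θ • (x - μ))).ennreal_ofReal
  have hmap : Measure.map (fun x : EuclideanSpace ℝ (Fin d) => μ + θ⁻¹ • (x - μ)) volume =
      ENNReal.ofReal (θ ^ d) • volume := by
    have h1 : (fun x : EuclideanSpace ℝ (Fin d) => μ + θ⁻¹ • (x - μ)) =
        (fun x => μ + x) ∘ (fun x => θ⁻¹ • x) ∘ fun x => x - μ := rfl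
    rw [h1, ← Measure.map_map (by fun_prop) (by fun_prop),
      ← Measure.map_map (by fun_prop) (by fun_prop), (measurePreserving_sub_right volume μ).map_eq,
      Measure.map_addHaar_smul _ (inv_ne_zero hθ.ne'), Measure.map_smul,
      (measurePreserving_add_left volume μ).map_eq, finrank_euclideanSpace_fin, inv_pow, inv_inv,
      abs_of_pos (by positivity)]
  ext S hS
  rw [Pdil, Measure.map_apply hTm hS, withDensity_apply _ (hTm hS), Measure.smul_apply,
    withDensity_apply _ hS, smul_eq_mul, ← smul_eq_mul, ← lintegral_smul_measure,
    ← Measure.restrict_smul, ← hmap, setLIntegral_map hS hFm hTm]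
  refine lintegral_congr fun x => ?_
  rw [fdil, add_sub_cancel_left, smul_inv_smul₀ hθ.ne', add_sub_cancel]

/-- The maximal function dominates `1/f` wherever the codebooks come close at a definite rate. -/
lemma ae_inv_density_le_maxFun {d : ℕ} (hd : 1 ≤ d) {s q : ℝ} (hs : 0 < s) (hq : 0 ≤ q)
    {f : EuclideanSpace ℝ (Fin d) → ℝ} (hfm : Measurable f)
    {P : Measure (EuclideanSpace ℝ (Fin d))} [IsProbabilityMeasure P]
    (hP : P = volume.withDensity fun x => ENNReal.ofReal (f x))
    {α : ℕ → Finset (EuclideanSpace ℝ (Fin d))} (hα : ∀ n, 1 ≤ n → (α n).Nonempty)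
    {b : ℝ} (hb : 0 < b) {M : ℝ}
    (hM : ∀ᶠ n : ℕ in atTop, ∀ ξ, ENNReal.ofReal (qdist ξ (α n)) ^ s ≤
        ENNReal.ofReal (M * (n : ℝ) ^ (-(s / d))) * maxFun P α b ξ ^ q) :
    ∀ᵐ x ∂(volume : Measure (EuclideanSpace ℝ (Fin d))),
      (ENNReal.ofReal (f x))⁻¹ ≤ maxFun P α b x := by
  have hd0 : (0 : ℝ) < d := by exact_mod_cast hd
  have : Nonempty (Fin d) := ⟨⟨0, hd⟩⟩
  have hac : P ≪ volume := hP ▸ withDensity_absolutelyContinuous _ _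
  have hnotMem : ∀ᵐ x ∂(volume : Measure (EuclideanSpace ℝ (Fin d))),
      ∀ n, x ∉ (α n : Set (EuclideanSpace ℝ (Fin d))) :=
    ae_all_iff.2 fun n => (α n).finite_toSet.countable.ae_notMem _
  have hderiv : P.rnDeriv volume =ᵐ[volume] fun x => ENNReal.ofReal (f x) := by
    rw [hP]
    exact Measure.rnDeriv_withDensity _ hfm.ennreal_ofReal
  filter_upwards [hnotMem, hderiv, Besicovitch.ae_tendsto_rnDeriv P volume] with x hx hfx hlim
  rcases eq_or_ne (maxFun P α b x) ⊤ with htop | htop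
  · rw [htop]
    exact le_top
  have hDpos : ∀ n, 1 ≤ n → 0 < qdist x (α n) := fun n hn => by
    refine (infDist_pos_iff_notMem_closure (Finset.coe_nonempty.2 (hα n hn))).1 ?_
    rw [(α n).finite_toSet.isClosed.closure_eq]
    exact hx n
  have hD0 : Tendsto (fun n => qdist x (α n)) atTop (𝓝 0) := by
    have h1 : Tendsto (fun n : ℕ => ENNReal.ofReal (M * (n : ℝ) ^ (-(s / d)))
        * maxFun P α b x ^ q) atTop (𝓝 0) := by
      have h2 : Tendsto (fun n : ℕ => M * (n : ℝ) ^ (-(s / d))) atTop (𝓝 (M * 0)) :=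
        ((tendsto_rpow_neg_atTop (by positivity)).comp tendsto_natCast_atTop_atTop).const_mul M
      have h3 := ENNReal.Tendsto.mul_const (ENNReal.tendsto_ofReal h2)
        (Or.inr (ENNReal.rpow_ne_top_of_nonneg hq htop))
      simpa using h3
    have h4 : Tendsto (fun n => ENNReal.ofReal (qdist x (α n)) ^ s) atTop (𝓝 0) :=
      tendsto_of_tendsto_of_tendsto_of_le_of_le' tendsto_const_nhds h1
        (Eventually.of_forall fun _ => zero_le) (hM.mono fun n hn => hn x)
    have h5 := (ENNReal.continuous_rpow_const (y := s⁻¹)).tendsto 0 |>.comp h4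
    rw [ENNReal.zero_rpow_of_pos (by positivity)] at h5
    have h6 := (ENNReal.tendsto_toReal ENNReal.zero_ne_top).comp h5
    refine h6.congr fun n => ?_
    simp only [Function.comp_apply]
    rw [← ENNReal.rpow_mul, mul_inv_cancel₀ hs.ne', ENNReal.rpow_one,
      ENNReal.toReal_ofReal (qdist_nonneg _ _)]
  have hbD : Tendsto (fun n => b * qdist x (α n)) atTop (𝓝[>] 0) := by
    refine tendsto_nhdsWithin_iff.2 ⟨by simpa using hD0.const_mul b, ?_⟩
    filter_upwards [eventually_ge_atTop 1] with n hn
    exact mul_pos hb (hDpos n hn)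
  have hinv := (hlim.comp hbD).inv
  rw [hfx] at hinv
  refine le_of_tendsto hinv ?_
  filter_upwards [eventually_ge_atTop 1] with n hn
  have hrad : 0 < b * qdist x (α n) := mul_pos hb (hDpos n hn)
  have hPball : P (closedBall x (b * qdist x (α n))) = P (ball x (b * qdist x (α n))) := by
    refine le_antisymm ?_ (measure_mono ball_subset_closedBall)
    rw [← ball_union_sphere]
    refine (measure_union_le _ _).trans_eq ?_
    rw [hac (Measure.addHaar_sphere _ _ _), add_zero]
  simp only [Function.comp_apply]
  rw [hPball, Measure.addHaar_closedBall_eq_addHaar_ball,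
    ENNReal.inv_div (Or.inl measure_ball_lt_top.ne) (Or.inl (measure_ball_pos _ _ hrad).ne')]
  exact le_iSup₂_of_le (f := fun (n : ℕ) (_ : 1 ≤ n) => volume (ball x (b * qdist x (α n)))
      / P (ball x (b * qdist x (α n)))) n hn le_rfl

/-- **Remark 4.1: necessary and sufficient condition, `s > r`.**
Let `0 < r < s`, `θ > 0`, `μ ∈ ℝ^d`, `P = f·λ_d` with `E|X|^{r+η} < ∞`,
`(θ,μ)` `P`-admissible, `(α_n)` an `L^r(P)`-optimal sequence of quantizers with
`ψ_b^{s/(d+r)} ∈ L¹(P_{θ,μ})` for some `b ∈ (0,1/2)`.  Then `(α_n^{θ,μ})` is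
`L^s(P)`-rate-optimal iff `∫ f_{θ,μ} f^{-s/(d+r)} dλ_d < ∞`. -/
theorem stmt_9 {d : ℕ} (hd : 1 ≤ d) (μ : EuclideanSpace ℝ (Fin d))
    (θ r s : ℝ) (hθ : 0 < θ) (hr : 0 < r) (hs : 0 < s) (hrs : r < s)
    (f : EuclideanSpace ℝ (Fin d) → ℝ) (hf0 : ∀ x, 0 ≤ f x) (hfm : Measurable f)
    (P : Measure (EuclideanSpace ℝ (Fin d))) [IsProbabilityMeasure P]
    (hP : P = volume.withDensity fun x => ENNReal.ofReal (f x))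
    (η : ℝ) (hη : 0 < η)
    (hmom : (∫⁻ x, ENNReal.ofReal ‖x‖ ^ (r + η) ∂P) ≠ ⊤)
    (hadm : Admissible f θ μ)
    (α : ℕ → Finset (EuclideanSpace ℝ (Fin d))) (hα : OptimalSeq P r α)
    (b : ℝ) (hb : b ∈ Ioo (0 : ℝ) (1 / 2))
    (hψ : (∫⁻ x, maxFun P α b x ^ (s / ((d : ℝ) + r)) ∂(Pdil P θ μ)) < ⊤) :
    RateOptimal P s (fun n => dilate (α n) θ μ) ↔
      (∫⁻ x, ENNReal.ofReal (fdil f θ μ x) *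
        ENNReal.ofReal (f x) ^ (-(s / ((d : ℝ) + r)))) < ⊤ := by
  have hd0 : (0 : ℝ) < d := by exact_mod_cast hd
  have hq : 0 < s / ((d : ℝ) + r) := by positivity
  have hne : ∀ n, 1 ≤ n → (α n).Nonempty := fun n hn => (hα n hn).1
  obtain ⟨C, hC, hβ⟩ := exists_qerr_le hd hr hη P hmom
  have hrate : ∀ n : ℕ, 1 ≤ n → qerr P r (α n) ≤ ENNReal.ofReal (C * (n : ℝ) ^ (-(r / d))) := by
    intro n hn
    obtain ⟨β, hβne, hcard, hle⟩ := hβ n hn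
    exact (hα.qerr_le hr hn hβne hcard).trans hle
  obtain ⟨C', hC', hinc⟩ := hα.exists_qerr_le_succ_add hd hr hfm hP hC hrate
  obtain ⟨M, hM, hbound⟩ := hα.exists_qdist_rpow_le_maxFun hd hr hs hb hC'
    (fun n hn => ((hrate n hn).trans_lt ENNReal.ofReal_lt_top).ne) hinc
  have hPdil := Pdil_eq_smul_withDensity hθ μ hfm
  rw [← hP] at hPdil
  -- Under the integrability of the maximal function both assertions hold.
  refine iff_of_true ?_ ?_
  · set I := ∫⁻ x, maxFun P α b x ^ (s / ((d : ℝ) + r)) ∂(Pdil P θ μ)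
    have htop : ENNReal.ofReal θ ^ s * (ENNReal.ofReal M * I) < ⊤ :=
      ENNReal.mul_lt_top (ENNReal.rpow_lt_top_of_nonneg hs.le ENNReal.ofReal_ne_top)
        (ENNReal.mul_lt_top ENNReal.ofReal_lt_top hψ)
    refine lt_of_le_of_lt (limsup_le_of_le (by isBoundedDefault) ?_) htop
    filter_upwards [hbound, eventually_ge_atTop 1] with n hn hn1
    have hn0 : (0 : ℝ) < n := by exact_mod_cast hn1
    have hle : qerr (Pdil P θ μ) s (α n) ≤ ENNReal.ofReal (M * (n : ℝ) ^ (-(s / d))) * I := by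
      rw [← lintegral_const_mul' _ _ ENNReal.ofReal_ne_top]
      exact lintegral_mono hn
    have hcancel : (n : ℝ≥0∞) ^ (s / (d : ℝ)) * ENNReal.ofReal (M * (n : ℝ) ^ (-(s / d))) =
        ENNReal.ofReal M := by
      rw [← ENNReal.ofReal_natCast, ENNReal.ofReal_rpow_of_pos hn0,
        ← ENNReal.ofReal_mul (by positivity), mul_left_comm, ← Real.rpow_add hn0, add_neg_cancel,
        Real.rpow_zero, mul_one]
    rw [qerr_dilate hθ hs μ P (hne n hn1), mul_left_comm]
    refine mul_le_mul' le_rfl ?_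
    calc (n : ℝ≥0∞) ^ (s / (d : ℝ)) * qerr (Pdil P θ μ) s (α n)
        ≤ (n : ℝ≥0∞) ^ (s / (d : ℝ)) * (ENNReal.ofReal (M * (n : ℝ) ^ (-(s / d))) * I) := by
          gcongr
      _ = ENNReal.ofReal M * I := by rw [← mul_assoc, hcancel]
  · have hac : Pdil P θ μ ≪ volume := by
      rw [hPdil]
      exact (withDensity_absolutelyContinuous _ _).smul_left _
    have hae : ∀ᵐ x ∂(Pdil P θ μ), ENNReal.ofReal (f x) ^ (-(s / ((d : ℝ) + r))) ≤
        maxFun P α b x ^ (s / ((d : ℝ) + r)) := by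
      filter_upwards [hac.ae_le (ae_inv_density_le_maxFun hd hs hq.le hfm hP hne hb.1 hbound)]
        with x hx
      rw [ENNReal.rpow_neg, ← ENNReal.inv_rpow]
      exact ENNReal.rpow_le_rpow hx hq.le
    have hlt := (lintegral_mono_ae hae).trans_lt hψ
    have hFm : Measurable fun x => ENNReal.ofReal (fdil f θ μ x) :=
      (hfm.comp (by fun_prop : Measurable fun x => μ + θ • (x - μ))).ennreal_ofReal
    rw [hPdil, lintegral_smul_measure, lintegral_withDensity_eq_lintegral_mul _ hFm
      (hfm.ennreal_ofReal.pow_const _), smul_eq_mul] at hlt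
    exact ENNReal.lt_top_of_mul_ne_top_right hlt.ne
      (ENNReal.ofReal_pos.2 (by positivity)).ne'
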